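/- arXiv:2211.03829 — 3 statements merged into one kernel-verified Lean document; each statement's English description precedes it below -/
import Mathlib

section
/- Let A₁ > 0, A₂ < 0, A₃ > 0 be real numbers with A₂² ≥ 3·A₁·A₃, and set τ₁ = (−A₂ − √(A₂² − 3·A₁·A₃))/A₁. Then τ₁ > 0, and the function E(t) = (A₁t² + A₂t + A₃)/t³ is strictly decreasing on the interval (0, τ₁]. -/
/-- Lemma 1: for coefficients `A₁ > 0`, `A₂ < 0`, `A₃ > 0` with
`A₂² ≥ 3A₁A₃`, the threshold `τ₁ = (-A₂ - √(A₂² - 3A₁A₃))/A₁` is positive and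
`E(t) = (A₁t² + A₂t + A₃)/t³` is strictly decreasing on `(0, τ₁]`. -/
theorem stmt_5 (A1 A2 A3 : ℝ) (h1 : 0 < A1) (h2 : A2 < 0) (h3 : 0 < A3)
    (hdisc : 3 * A1 * A3 ≤ A2 ^ 2) :
    let τ1 : ℝ := (-A2 - Real.sqrt (A2 ^ 2 - 3 * A1 * A3)) / A1
    0 < τ1 ∧
      StrictAntiOn (fun t : ℝ => (A1 * t ^ 2 + A2 * t + A3) / t ^ 3) (Set.Ioc 0 τ1) := by
  intro τ1
  have hD : 0 ≤ A2 ^ 2 - 3 * A1 * A3 := by linarith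
  have hs0 := Real.sqrt_nonneg (A2 ^ 2 - 3 * A1 * A3)
  have hs2 := Real.sq_sqrt hD
  have hτ : τ1 * A1 = -A2 - Real.sqrt (A2 ^ 2 - 3 * A1 * A3) := by
    simp only [τ1]
    field_simp
  clear_value τ1
  generalize Real.sqrt (A2 ^ 2 - 3 * A1 * A3) = s at *
  have h13 : 0 < A1 * A3 := mul_pos h1 h3
  refine ⟨?_, ?_⟩
  · have : s < -A2 := by
      apply lt_of_pow_lt_pow_left₀ 2 (by linarith)
      nlinarith
    exact pos_of_mul_pos_left (by linarith : 0 < τ1 * A1) h1.le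
  · apply strictAntiOn_of_deriv_neg (convex_Ioc 0 τ1)
    · apply ContinuousOn.div (by fun_prop) (by fun_prop)
      intro t ht
      exact pow_ne_zero 3 ht.1.ne'
    · intro t ht
      rw [interior_Ioc] at ht
      obtain ⟨ht0, ht1⟩ := ht
      have hq : 0 < A1 * t ^ 2 + 2 * A2 * t + 3 * A3 := by
        have h4 : t * A1 < τ1 * A1 := mul_lt_mul_of_pos_right ht1 h1
        have h5 : s < -(t * A1 + A2) := by linarith
        have h6 : s ^ 2 < (-(t * A1 + A2)) ^ 2 := pow_lt_pow_left₀ h5 hs0 (by norm_num)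
        have h7 : 0 < A1 * (A1 * t ^ 2 + 2 * A2 * t + 3 * A3) := by nlinarith
        exact pos_of_mul_pos_right h7 h1.le
      have hd : HasDerivAt (fun t : ℝ => (A1 * t ^ 2 + A2 * t + A3) / t ^ 3)
          (-(A1 * t ^ 2 + 2 * A2 * t + 3 * A3) / t ^ 4) t := by
        have hn : HasDerivAt (fun t : ℝ => A1 * t ^ 2 + A2 * t + A3)
            (A1 * (2 * t) + A2) t := by
          have := (((hasDerivAt_pow 2 t).const_mul A1).add
            ((hasDerivAt_id t).const_mul A2)).add_const A3
          exact this.congr_deriv (by simp)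
        have := hn.div (hasDerivAt_pow 3 t) (pow_ne_zero 3 ht0.ne')
        refine this.congr_deriv ?_
        field_simp
        push_cast
        ring
      rw [hd.deriv]
      exact div_neg_of_neg_of_pos (by linarith) (by positivity)
end

section
/- Let t₀ < t_f be real numbers and x₀, v₀, L, v_m real numbers. Let p be the unique polynomial of degree at most 3 with p(t₀) = x₀, p'(t₀) = v₀, p(t_f) = L, p'(t_f) = v_m. Then for every twice continuously differentiable function x : [t₀, t_f] → ℝ with x(t₀) = x₀, x'(t₀) = v₀, x(t_f) = L, x'(t_f) = v_m, one has ∫_{t₀}^{t_f} x''(t)² dt ≥ ∫_{t₀}^{t_f} p''(t)² dt. -/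
/-- Energy optimality of the cubic trajectory: among all twice continuously
differentiable trajectories on `[t₀, t_f]` with the same boundary positions and
velocities, the cubic Hermite interpolant `p` minimizes `∫ x''(t)² dt`. -/
theorem stmt_11 (t0 tf x0 v0 L vm : ℝ) (h : t0 < tf)
    (p : Polynomial ℝ) (hdeg : p.degree ≤ 3)
    (hp0 : p.eval t0 = x0) (hp0' : p.derivative.eval t0 = v0)
    (hpf : p.eval tf = L) (hpf' : p.derivative.eval tf = vm)
    (x : ℝ → ℝ) (hx : ContDiffOn ℝ 2 x (Set.Icc t0 tf))
    (hx0 : x t0 = x0) (hx0' : derivWithin x (Set.Icc t0 tf) t0 = v0)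
    (hxf : x tf = L) (hxf' : derivWithin x (Set.Icc t0 tf) tf = vm) :
    ∫ s in t0..tf, (p.derivative.derivative.eval s) ^ 2 ≤
      ∫ s in t0..tf, (derivWithin (derivWithin x (Set.Icc t0 tf)) (Set.Icc t0 tf) s) ^ 2 := by
  set I := Set.Icc t0 tf with hI
  set v := derivWithin x I with hv
  set w := derivWithin v I with hw
  have hu : UniqueDiffOn ℝ I := uniqueDiffOn_Icc h
  have hv1 : ContDiffOn ℝ 1 v I := hx.derivWithin hu (by norm_num)
  have hwc : ContinuousOn w I := hv1.continuousOn_derivWithin hu le_rfl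
  have hvc : ContinuousOn v I := hv1.continuousOn
  have hxc : ContinuousOn x I := hx.continuousOn
  have hxd : ∀ s ∈ Set.Ioo t0 tf, HasDerivAt x (v s) s := fun s hs =>
    ((hx.differentiableOn (by norm_num)) s (Set.Ioo_subset_Icc_self hs)).hasDerivWithinAt.hasDerivAt
      (Icc_mem_nhds hs.1 hs.2)
  have hvd : ∀ s ∈ Set.Ioo t0 tf, HasDerivAt v (w s) s := fun s hs =>
    ((hv1.differentiableOn (by norm_num)) s (Set.Ioo_subset_Icc_self hs)).hasDerivWithinAt.hasDerivAt
      (Icc_mem_nhds hs.1 hs.2)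
  set p1 := Polynomial.derivative p with hp1
  set q := Polynomial.derivative p1 with hq
  set c := Polynomial.derivative q with hc
  have hc0 : Polynomial.derivative c = 0 := by
    have h4 : p.natDegree < 4 :=
      lt_of_le_of_lt (Polynomial.natDegree_le_of_degree_le hdeg) (by norm_num)
    exact Polynomial.iterate_derivative_eq_zero h4
  have hqc : ContinuousOn (fun s => q.eval s) I := q.continuous.continuousOn
  have hp1c : ContinuousOn (fun s => p1.eval s) I := p1.continuous.continuousOn
  have hpc : ContinuousOn (fun s => p.eval s) I := p.continuous.continuousOn
  have hcc : ContinuousOn (fun s => c.eval s) I := c.continuous.continuousOn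
  have hcross : ContinuousOn (fun s => q.eval s * (w s - q.eval s)) I := hqc.mul (hwc.sub hqc)
  have hzero : ∫ s in t0..tf, q.eval s * (w s - q.eval s) = 0 := by
    have key := intervalIntegral.integral_eq_sub_of_hasDerivAt_of_le
      (f := fun s => q.eval s * (v s - p1.eval s) - c.eval s * (x s - p.eval s))
      (f' := fun s => q.eval s * (w s - q.eval s)) h.le
      ((hqc.mul (hvc.sub hp1c)).sub (hcc.mul (hxc.sub hpc)))
      (fun s hs => by
        have h1 := (q.hasDerivAt s).mul ((hvd s hs).sub (p1.hasDerivAt s))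
        have h2 := (c.hasDerivAt s).mul ((hxd s hs).sub (p.hasDerivAt s))
        refine (h1.sub h2).congr_deriv ?_
        rw [hc0, ← hc, ← hq, ← hp1]
        simp only [Pi.sub_apply, Polynomial.eval_zero]
        ring)
      (hcross.intervalIntegrable_of_Icc h.le)
    rw [key]
    simp only [hx0, hxf, hx0', hxf', hp0, hp0', hpf, hpf']
    ring
  have hq2 : IntervalIntegrable (fun s => q.eval s ^ 2) MeasureTheory.volume t0 tf :=
    (hqc.pow 2).intervalIntegrable_of_Icc h.le
  have hcr : IntervalIntegrable (fun s => 2 * (q.eval s * (w s - q.eval s)))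
      MeasureTheory.volume t0 tf :=
    (hcross.intervalIntegrable_of_Icc h.le).const_mul 2
  have hw2 : IntervalIntegrable (fun s => w s ^ 2) MeasureTheory.volume t0 tf :=
    (hwc.pow 2).intervalIntegrable_of_Icc h.le
  calc ∫ s in t0..tf, q.eval s ^ 2
      = ∫ s in t0..tf, (q.eval s ^ 2 + 2 * (q.eval s * (w s - q.eval s))) := by
        rw [intervalIntegral.integral_add hq2 hcr, intervalIntegral.integral_const_mul, hzero]
        ring
    _ ≤ ∫ s in t0..tf, w s ^ 2 :=
        intervalIntegral.integral_mono_on h.le (hq2.add hcr) hw2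
          (fun s _ => by nlinarith [sq_nonneg (w s - q.eval s)])
end

section
/- Let t₀ < t_f be real numbers, set T = t_f − t₀, and let x₀, v₀, L, v_m be real numbers. Let p be the unique polynomial of degree at most 3 with p(t₀) = x₀, p'(t₀) = v₀, p(t_f) = L, p'(t_f) = v_m. Then ∫_{t₀}^{t_f} (1/2)·p''(t)² dt = (2T²(v₀² + v₀·v_m + v_m²) − 6T(L − x₀)(v₀ + v_m) + 6(L − x₀)²)/T³. -/
/-- Closed-form AV energy (equation (34)): the energy of the cubic Hermite
interpolant is
`(2T²(v₀² + v₀v_m + v_m²) - 6T(L - x₀)(v₀ + v_m) + 6(L - x₀)²)/T³`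
with `T = t_f - t₀`. -/
theorem stmt_12 (t0 tf x0 v0 L vm : ℝ) (h : t0 < tf)
    (p : Polynomial ℝ) (hdeg : p.degree ≤ 3)
    (hp0 : p.eval t0 = x0) (hp0' : p.derivative.eval t0 = v0)
    (hpf : p.eval tf = L) (hpf' : p.derivative.eval tf = vm) :
    ∫ s in t0..tf, (1 / 2) * (p.derivative.derivative.eval s) ^ 2 =
      (2 * (tf - t0) ^ 2 * (v0 ^ 2 + v0 * vm + vm ^ 2)
        - 6 * (tf - t0) * (L - x0) * (v0 + vm) + 6 * (L - x0) ^ 2) / (tf - t0) ^ 3 := by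
  have hne : tf - t0 ≠ 0 := sub_ne_zero.mpr h.ne'
  obtain ⟨a, b, c, d, rfl⟩ : ∃ a b c d : ℝ, p = Polynomial.C a + Polynomial.C b * Polynomial.X
      + Polynomial.C c * Polynomial.X ^ 2 + Polynomial.C d * Polynomial.X ^ 3 := by
    refine ⟨p.coeff 0, p.coeff 1, p.coeff 2, p.coeff 3, ?_⟩
    have hn : p.natDegree < 4 :=
      Nat.lt_succ_of_le (Polynomial.natDegree_le_of_degree_le hdeg)
    conv_lhs => rw [p.as_sum_range_C_mul_X_pow' hn]
    simp [Finset.sum_range_succ]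
  have hint : ∀ s : ℝ, HasDerivAt (fun s : ℝ => 2 * c ^ 2 * s + 6 * c * d * s ^ 2 + 6 * d ^ 2 * s ^ 3)
      (2 * c ^ 2 + 12 * c * d * s + 18 * d ^ 2 * s ^ 2) s := by
    intro s
    have h1 := (hasDerivAt_id s).const_mul (2 * c ^ 2)
    have h2 := (hasDerivAt_pow 2 s).const_mul (6 * c * d)
    have h3 := (hasDerivAt_pow 3 s).const_mul (6 * d ^ 2)
    exact ((h1.add h2).add h3).congr_deriv (by push_cast; ring)
  have hf : ∀ s : ℝ, (1 / 2) * ((Polynomial.C a + Polynomial.C b * Polynomial.X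
      + Polynomial.C c * Polynomial.X ^ 2
      + Polynomial.C d * Polynomial.X ^ 3).derivative.derivative.eval s) ^ 2
      = 2 * c ^ 2 + 12 * c * d * s + 18 * d ^ 2 * s ^ 2 := by
    intro s
    simp
    ring
  simp_rw [hf]
  rw [intervalIntegral.integral_eq_sub_of_hasDerivAt (fun s _ => hint s)
    (Continuous.intervalIntegrable (by fun_prop) _ _)]
  simp at hp0 hp0' hpf hpf'
  subst hp0 hp0' hpf hpf'
  rw [eq_div_iff (pow_ne_zero 3 hne)]
  ring
end
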